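/- Let g_0 ≥ 0 and r ≥ 0 be integers and let m_1, ..., m_r be integers with each m_i ≥ 2. If the rational number s = 2g_0 − 2 + Σ_{i=1}^{r} (1 − 1/m_i) is positive, then s ≥ 1/42. -/

import Mathlib

/-- The reciprocal of a natural number is antitone on positive numbers. -/
lemma one_div_natCast_le {k n : ℕ} (hk : 0 < k) (h : k ≤ n) : 1 / (n : ℚ) ≤ 1 / (k : ℚ) :=
  one_div_le_one_div_of_le (by exact_mod_cast hk) (by exact_mod_cast h)

/-- A sum of three unit fractions with increasing denominators that is less than `1` is at most
`41/42`. -/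
lemma sum_three_unit_fractions_le_of_le {a b c : ℕ} (ha : 2 ≤ a) (hab : a ≤ b) (hbc : b ≤ c)
    (h : 1 / (a : ℚ) + 1 / (b : ℚ) + 1 / (c : ℚ) < 1) :
    1 / (a : ℚ) + 1 / (b : ℚ) + 1 / (c : ℚ) ≤ 41 / 42 := by
  have hb := one_div_natCast_le (by omega) hab
  have hc := one_div_natCast_le (by omega) hbc
  have hc0 : 0 < 1 / (c : ℚ) := one_div_pos.2 (by exact_mod_cast (by omega : 0 < c))
  obtain rfl | rfl | ha4 : a = 2 ∨ a = 3 ∨ 4 ≤ a := by omega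
  · obtain rfl | rfl | rfl | hb5 : b = 2 ∨ b = 3 ∨ b = 4 ∨ 5 ≤ b := by omega
    · norm_num at h hc0
      linarith
    · obtain hc7 | hc6 : 7 ≤ c ∨ c ≤ 6 := by omega
      · have := one_div_natCast_le (by norm_num) hc7
        push_cast at *
        linarith
      · have := one_div_natCast_le (by omega) hc6
        push_cast at *
        linarith
    · obtain hc5 | rfl : 5 ≤ c ∨ c = 4 := by omega
      · have := one_div_natCast_le (by norm_num) hc5
        push_cast at *
        linarith
      · norm_num at h
    · have := one_div_natCast_le (by norm_num) hb5
      push_cast at *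
      linarith
  · obtain rfl | hb4 : b = 3 ∨ 4 ≤ b := by omega
    · obtain hc4 | rfl : 4 ≤ c ∨ c = 3 := by omega
      · have := one_div_natCast_le (by norm_num) hc4
        push_cast at *
        linarith
      · norm_num at h
    · have := one_div_natCast_le (by norm_num) hb4
      push_cast at *
      linarith
  · have := one_div_natCast_le (by norm_num) ha4
    push_cast at *
    linarith

/-- A sum of three unit fractions with denominators at least `2` that is less than `1` is at most
`41/42`. -/
lemma sum_three_unit_fractions_le {a b c : ℕ} (ha : 2 ≤ a) (hb : 2 ≤ b) (hc : 2 ≤ c)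
    (h : 1 / (a : ℚ) + 1 / (b : ℚ) + 1 / (c : ℚ) < 1) :
    1 / (a : ℚ) + 1 / (b : ℚ) + 1 / (c : ℚ) ≤ 41 / 42 := by
  rcases le_total a b with hab | hab <;> rcases le_total b c with hbc | hbc <;>
    rcases le_total a c with hac | hac
  · linarith [sum_three_unit_fractions_le_of_le ha hab hbc (by linarith)]
  · linarith [sum_three_unit_fractions_le_of_le ha hab hbc (by linarith)]
  · linarith [sum_three_unit_fractions_le_of_le ha hac hbc (by linarith)]
  · linarith [sum_three_unit_fractions_le_of_le hc hac hab (by linarith)]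
  · linarith [sum_three_unit_fractions_le_of_le hb hab hac (by linarith)]
  · linarith [sum_three_unit_fractions_le_of_le hb hbc hac (by linarith)]
  · linarith [sum_three_unit_fractions_le_of_le hc hbc hab (by linarith)]
  · linarith [sum_three_unit_fractions_le_of_le hc hbc hab (by linarith)]

/-- A unit fraction with denominator at least `2` is `1/2` or at most `1/3`. -/
lemma one_div_natCast_eq_half_or_le_third {n : ℕ} (h : 2 ≤ n) :
    1 / (n : ℚ) = 1 / 2 ∨ 1 / (n : ℚ) ≤ 1 / 3 := by
  obtain rfl | h3 : n = 2 ∨ 3 ≤ n := by omega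
  · exact Or.inl (by norm_num)
  · exact Or.inr (by simpa using one_div_natCast_le (by norm_num) h3)

/-- If `g₀ ≥ 0`, `r ≥ 0` and `m 0, ..., m (r-1) ≥ 2` are integers and the rational number
`s = 2g₀ - 2 + Σᵢ (1 - 1/mᵢ)` is positive, then `s ≥ 1/42`. -/
theorem riemann_hurwitz_quantity_ge_one_div_42
    (g₀ r : ℕ) (m : ℕ → ℕ) (hm : ∀ i ∈ Finset.range r, 2 ≤ m i)
    (s : ℚ) (hs : s = 2 * (g₀ : ℚ) - 2 + ∑ i ∈ Finset.range r, (1 - 1 / (m i : ℚ)))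
    (hpos : 0 < s) :
    1 / 42 ≤ s := by
  have hsum : (r : ℚ) / 2 ≤ ∑ i ∈ Finset.range r, (1 - 1 / (m i : ℚ)) := by
    have := Finset.card_nsmul_le_sum (Finset.range r) (fun i => 1 - 1 / (m i : ℚ)) (1 / 2)
      fun i hi => by
        have := one_div_natCast_le (by norm_num) (hm i hi)
        push_cast at this
        linarith
    simp only [Finset.card_range, nsmul_eq_mul] at this
    linarith
  obtain hlarge | hsmall : 5 ≤ 4 * g₀ + r ∨ 4 * g₀ + r ≤ 4 := by omega
  · have : (5 : ℚ) ≤ 4 * g₀ + r := by exact_mod_cast hlarge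
    linarith
  obtain ⟨rfl, rfl⟩ | ⟨rfl, hr⟩ : (g₀ = 1 ∧ r = 0) ∨ (g₀ = 0 ∧ r ≤ 4) := by omega
  · norm_num at hs
    linarith
  simp only [Finset.mem_range] at hm
  have hnonneg (i : ℕ) : 0 ≤ 1 / (m i : ℚ) := by positivity
  interval_cases r <;> simp only [Finset.sum_range_succ, Finset.sum_range_zero] at hs <;>
    push_cast at hs
  · linarith
  · linarith [hnonneg 0]
  · linarith [hnonneg 0, hnonneg 1]
  · linarith [sum_three_unit_fractions_le (hm 0 (by norm_num)) (hm 1 (by norm_num))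
      (hm 2 (by norm_num)) (by linarith)]
  · rcases one_div_natCast_eq_half_or_le_third (hm 0 (by norm_num)) with h0 | h0 <;>
      rcases one_div_natCast_eq_half_or_le_third (hm 1 (by norm_num)) with h1 | h1 <;>
      rcases one_div_natCast_eq_half_or_le_third (hm 2 (by norm_num)) with h2 | h2 <;>
      rcases one_div_natCast_eq_half_or_le_third (hm 3 (by norm_num)) with h3 | h3 <;>
      linarith
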